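/- arXiv:1112.3540 — 2 statements merged into one kernel-verified Lean document; each statement's English description precedes it below -/
import Mathlib

section
/- Let m ≥ 1, let V ⊆ ℝ^m be a rational linear subspace, and let D₀ ∈ ℤ^m. Suppose the set { P ∈ V ∩ ℤ^m : P + D₀ ≥ 0 componentwise } is infinite. Then there exists a nonzero Q ∈ V ∩ ℤ^m with Q ≥ 0 componentwise such that the set { P ∈ V ∩ ℤ^m : P + D₀ − Q ≥ 0 componentwise } is infinite. -/
/-!
Statement 10: if a rational linear subspace `V ⊆ ℝ^m` contains infinitely many integer
points `P` with `P + D₀ ≥ 0`, then there is a nonzero nonnegative integer point `Q ∈ V`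
such that infinitely many integer points `P ∈ V` satisfy `P + D₀ − Q ≥ 0`.
-/

theorem exists_nonneg_integral_direction (m : ℕ) (hm : 1 ≤ m)
    (V : Submodule ℝ (Fin m → ℝ))
    (hV : V = Submodule.span ℝ {x : Fin m → ℝ | x ∈ V ∧ ∀ j, ∃ q : ℚ, x j = (q : ℝ)})
    (D₀ : Fin m → ℤ)
    (hinf : {P : Fin m → ℝ | P ∈ V ∧ (∀ j, ∃ z : ℤ, P j = (z : ℝ)) ∧
      ∀ j, 0 ≤ P j + (D₀ j : ℝ)}.Infinite) :
    ∃ Q : Fin m → ℝ, Q ∈ V ∧ (∀ j, ∃ z : ℤ, Q j = (z : ℝ)) ∧ Q ≠ 0 ∧ (∀ j, 0 ≤ Q j) ∧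
      {P : Fin m → ℝ | P ∈ V ∧ (∀ j, ∃ z : ℤ, P j = (z : ℝ)) ∧
        ∀ j, 0 ≤ P j + (D₀ j : ℝ) - Q j}.Infinite := by
  -- By the Dickson lemma there are two comparable points of the infinite set; their difference is `Q`.
  let f := hinf.natEmbedding
  have hf : ∀ n j, ∃ k : ℕ, (f n : Fin m → ℝ) j + (D₀ j : ℝ) = k := by
    intro n j
    obtain ⟨-, hint, hnonneg⟩ := (f n).2
    obtain ⟨z, hz⟩ := hint j
    have h := hnonneg j
    rw [hz] at h ⊢
    lift z + D₀ j to ℕ using (by exact_mod_cast h) with k hk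
    exact ⟨k, by exact_mod_cast hk.symm⟩
  choose g hg using hf
  obtain ⟨a, b, hab, hle⟩ := wellQuasiOrdered_le g
  obtain ⟨haV, haZ, -⟩ := (f a).2
  obtain ⟨hbV, hbZ, -⟩ := (f b).2
  have hQV : (f b : Fin m → ℝ) - f a ∈ V := V.sub_mem hbV haV
  have hQZ : ∀ j, ∃ z : ℤ, ((f b : Fin m → ℝ) - f a) j = z := by
    intro j
    obtain ⟨x, hx⟩ := haZ j
    obtain ⟨y, hy⟩ := hbZ j
    exact ⟨y - x, by simp [hx, hy]⟩
  refine ⟨(f b : Fin m → ℝ) - f a, hQV, hQZ, ?_, fun j => ?_, ?_⟩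
  · rw [sub_ne_zero]
    exact fun h => hab.ne' (f.injective (Subtype.ext h))
  · have h : (g a j : ℝ) ≤ g b j := by exact_mod_cast hle j
    rw [← hg, ← hg] at h
    simpa using h
  · refine (hinf.image (add_left_injective ((f b : Fin m → ℝ) - f a)).injOn).mono ?_
    rintro _ ⟨P, ⟨hPV, hPZ, hP⟩, rfl⟩
    refine ⟨V.add_mem hPV hQV, fun j => ?_, fun j => ?_⟩
    · obtain ⟨x, hx⟩ := hPZ j
      obtain ⟨y, hy⟩ := hQZ j
      exact ⟨x + y, by push_cast; exact congrArg₂ (· + ·) hx hy⟩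
    · have h := hP j
      simp only [Pi.add_apply]
      linarith
end

section
/- Let m, κ ≥ 1, let z : {1, …, κ} → {1, …, m} be any function, let T be a set of squarefree monomials in ℤ[x₁, …, x_κ], and let I ⊆ ℤ[x₁, …, x_κ] be the ideal generated by T. For a vector P ∈ ℤ^m with P ≥ 0 componentwise, define the monomial λ(P) := ∏_{i=1}^κ x_i^{P_{z(i)}} ∈ ℤ[x₁, …, x_κ]. Let G ⊆ ℤ^m be a subgroup with the property that every nonzero P ∈ G with P ≥ 0 componentwise satisfies λ(P) ∈ I. Then for every D₀ ∈ ℤ^m, the set { P ∈ G : P + D₀ ≥ 0 componentwise and λ(P + D₀) ∉ I } is finite. -/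
/-!
Statement 11: finiteness of positive classes with nonvanishing monomial. Given a marking
`z : {1,…,κ} → {1,…,m}`, an ideal `I` generated by squarefree monomials in
`ℤ[x₁,…,x_κ]`, and a subgroup `G ≤ ℤ^m` all of whose nonzero nonnegative elements have
associated monomial `λ(P) = ∏ᵢ xᵢ^{P_{z(i)}}` in `I`, for every `D₀ ∈ ℤ^m` only finitely
many `P ∈ G` satisfy `P + D₀ ≥ 0` and `λ(P + D₀) ∉ I`.
-/

open MvPolynomial

/-- Dickson's lemma for antichains of integer vectors with a common lower bound. -/
theorem IsAntichain.finite_of_int_lower_bound {ι : Type*} [Finite ι] {S : Set (ι → ℤ)}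
    (hS : IsAntichain (· ≤ ·) S) (b : ι → ℤ) (hb : ∀ P ∈ S, b ≤ P) : S.Finite := by
  have hmono : Monotone fun (n : ι → ℕ) (j : ι) => (n j : ℤ) + b j := fun u v h j => by
    simpa using h j
  have hpwo : (Set.range fun (n : ι → ℕ) (j : ι) => (n j : ℤ) + b j).IsPWO := by
    rw [← Set.image_univ]
    exact (Set.isPWO_of_wellQuasiOrderedLE _).image_of_monotone hmono
  refine hS.finite_of_partiallyWellOrderedOn
    (hpwo.mono fun P hP => ⟨fun j => (P j - b j).toNat, ?_⟩)
  funext j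
  have : b j ≤ P j := hb P hP j
  dsimp only
  omega

theorem finitely_many_classes_with_nonvanishing_monomial
    (m κ : ℕ) (hm : 1 ≤ m) (hκ : 1 ≤ κ) (z : Fin κ → Fin m)
    (T : Set (MvPolynomial (Fin κ) ℤ))
    (hT : ∀ p ∈ T, ∃ s : Finset (Fin κ), p = ∏ i ∈ s, MvPolynomial.X i)
    (G : AddSubgroup (Fin m → ℤ))
    (hG : ∀ P ∈ G, P ≠ 0 → (∀ j, 0 ≤ P j) →
      (∏ i : Fin κ, (MvPolynomial.X i : MvPolynomial (Fin κ) ℤ) ^ (P (z i)).toNat)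
        ∈ Ideal.span T)
    (D₀ : Fin m → ℤ) :
    {P : Fin m → ℤ | P ∈ G ∧ (∀ j, 0 ≤ P j + D₀ j) ∧
      (∏ i : Fin κ, (MvPolynomial.X i : MvPolynomial (Fin κ) ℤ) ^ (P (z i) + D₀ (z i)).toNat)
        ∉ Ideal.span T}.Finite := by
  refine IsAntichain.finite_of_int_lower_bound ?_ (-D₀) fun P hP j => ?_
  · rintro P ⟨hPG, hP, -⟩ Q ⟨hQG, -, hQI⟩ hne hle
    refine hQI ?_
    have hmem := hG (Q - P) (G.sub_mem hQG hPG) (sub_ne_zero.mpr hne.symm)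
      fun j => sub_nonneg.mpr (hle j)
    convert Ideal.mul_mem_left _
      (∏ i : Fin κ, (X i : MvPolynomial (Fin κ) ℤ) ^ (P (z i) + D₀ (z i)).toNat) hmem using 1
    rw [← Finset.prod_mul_distrib]
    refine Finset.prod_congr rfl fun i _ => ?_
    rw [← pow_add]
    congr 1
    have h₁ : 0 ≤ P (z i) + D₀ (z i) := hP (z i)
    have h₂ : P (z i) ≤ Q (z i) := hle (z i)
    rw [Pi.sub_apply]
    omega
  · have : 0 ≤ P j + D₀ j := hP.2.1 j
    change -D₀ j ≤ P j
    omega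
end
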